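/- Let H(ℝ) = GSp_4(ℝ), R(ℝ) = T(ℝ)U(ℝ) the Bessel subgroup for positive definite S, t₀ ∈ GL_2(ℝ)^+ with T¹(ℝ) = t₀ SO(2) t₀^{-1}, and K^H_∞ the maximal compact subgroup stabilizing I. Then every element of H(ℝ) can be written as r · diag-block(λ t₀ diag(ζ, ζ^{-1}), ^t t₀^{-1} diag(ζ^{-1}, ζ)) · k with r ∈ R(ℝ), λ ∈ ℝ^×, ζ ≥ 1, k ∈ K^H_∞, and the double cosets for distinct (sign of λ inequivalent under center, ζ) are disjoint. -/

import Mathlib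

open Matrix Real

noncomputable section

/-- The symplectic form `J = [[0,1₂],[-1₂,0]]` over `ℝ`. -/
def Jsp : Matrix (Fin 4) (Fin 4) ℝ :=
  !![0, 0, 1, 0; 0, 0, 0, 1; -1, 0, 0, 0; 0, -1, 0, 0]

/-- `h ∈ H(ℝ) = GSp₄(ℝ)`. -/
def memH (h : Matrix (Fin 4) (Fin 4) ℝ) : Prop :=
  ∃ μ : ℝ, μ ≠ 0 ∧ hᵀ * Jsp * h = μ • Jsp

/-- Embedding `T(ℝ) ∋ g ↦ diag-block(g, det(g)·ᵀg⁻¹)`. -/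
def embedT (g : Matrix (Fin 2) (Fin 2) ℝ) : Matrix (Fin 4) (Fin 4) ℝ :=
  !![g 0 0, g 0 1, 0, 0;
     g 1 0, g 1 1, 0, 0;
     0, 0, g.det * (g⁻¹)ᵀ 0 0, g.det * (g⁻¹)ᵀ 0 1;
     0, 0, g.det * (g⁻¹)ᵀ 1 0, g.det * (g⁻¹)ᵀ 1 1]

/-- `u(X) = [[1,X],[0,1]]`. -/
def uMat (X : Matrix (Fin 2) (Fin 2) ℝ) : Matrix (Fin 4) (Fin 4) ℝ :=
  !![1, 0, X 0 0, X 0 1;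
     0, 1, X 1 0, X 1 1;
     0, 0, 1, 0;
     0, 0, 0, 1]

/-- The Bessel subgroup `R(ℝ) = T(ℝ)U(ℝ)` attached to `S`. -/
def Rset (S : Matrix (Fin 2) (Fin 2) ℝ) : Set (Matrix (Fin 4) (Fin 4) ℝ) :=
  {r | ∃ (g X : Matrix (Fin 2) (Fin 2) ℝ),
    gᵀ * S * g = g.det • S ∧ g.det ≠ 0 ∧ Xᵀ = X ∧ r = embedT g * uMat X}

/-- The maximal compact subgroup `K^H_∞ = {[[A,B],[-B,A]] : ᵀAB = ᵀBA, ᵀAA + ᵀBB = 1}`. -/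
def KHset : Set (Matrix (Fin 4) (Fin 4) ℝ) :=
  {k | ∃ A B : Matrix (Fin 2) (Fin 2) ℝ,
    Aᵀ * B = Bᵀ * A ∧ Aᵀ * A + Bᵀ * B = 1 ∧
    k = !![A 0 0, A 0 1, B 0 0, B 0 1;
           A 1 0, A 1 1, B 1 0, B 1 1;
           -B 0 0, -B 0 1, A 0 0, A 0 1;
           -B 1 0, -B 1 1, A 1 0, A 1 1]}

/-- The rotation matrix in `SO(2)`. -/
def rot (θ : ℝ) : Matrix (Fin 2) (Fin 2) ℝ :=
  !![Real.cos θ, Real.sin θ; -Real.sin θ, Real.cos θ]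

/-- The middle representative `diag-block(λ t₀ diag(ζ,ζ⁻¹), ᵀt₀⁻¹ diag(ζ⁻¹,ζ))`. -/
def midRep (t₀ : Matrix (Fin 2) (Fin 2) ℝ) (lam ζ : ℝ) : Matrix (Fin 4) (Fin 4) ℝ :=
  !![(lam • (t₀ * !![ζ, 0; 0, ζ⁻¹])) 0 0, (lam • (t₀ * !![ζ, 0; 0, ζ⁻¹])) 0 1, 0, 0;
     (lam • (t₀ * !![ζ, 0; 0, ζ⁻¹])) 1 0, (lam • (t₀ * !![ζ, 0; 0, ζ⁻¹])) 1 1, 0, 0;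
     0, 0, ((t₀⁻¹)ᵀ * !![ζ⁻¹, 0; 0, ζ]) 0 0, ((t₀⁻¹)ᵀ * !![ζ⁻¹, 0; 0, ζ]) 0 1;
     0, 0, ((t₀⁻¹)ᵀ * !![ζ⁻¹, 0; 0, ζ]) 1 0, ((t₀⁻¹)ᵀ * !![ζ⁻¹, 0; 0, ζ]) 1 1]

/-- A 4×4 matrix assembled from 2×2 blocks. -/
def blk (A B C D : Matrix (Fin 2) (Fin 2) ℝ) : Matrix (Fin 4) (Fin 4) ℝ :=
  !![A 0 0, A 0 1, B 0 0, B 0 1;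
     A 1 0, A 1 1, B 1 0, B 1 1;
     C 0 0, C 0 1, D 0 0, D 0 1;
     C 1 0, C 1 1, D 1 0, D 1 1]

theorem blk_mul (A B C D A' B' C' D' : Matrix (Fin 2) (Fin 2) ℝ) :
    blk A B C D * blk A' B' C' D' =
      blk (A * A' + B * C') (A * B' + B * D') (C * A' + D * C') (C * B' + D * D') := by
  ext i j
  fin_cases i <;> fin_cases j <;>
    simp [blk, Matrix.mul_apply, Fin.sum_univ_four, Fin.sum_univ_two] <;> ring

theorem blk_transpose (A B C D : Matrix (Fin 2) (Fin 2) ℝ) :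
    (blk A B C D)ᵀ = blk Aᵀ Cᵀ Bᵀ Dᵀ := by
  ext i j
  fin_cases i <;> fin_cases j <;> simp [blk]

theorem blk_smul (m : ℝ) (A B C D : Matrix (Fin 2) (Fin 2) ℝ) :
    m • (blk A B C D) = blk (m • A) (m • B) (m • C) (m • D) := by
  ext i j
  fin_cases i <;> fin_cases j <;> simp [blk]

theorem blk_one : blk 1 0 0 1 = 1 := by
  ext i j
  fin_cases i <;> fin_cases j <;> simp [blk]

theorem Jsp_eq : Jsp = blk 0 1 (-1) 0 := by
  ext i j
  fin_cases i <;> fin_cases j <;> simp [blk, Jsp]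

theorem uMat_eq (X : Matrix (Fin 2) (Fin 2) ℝ) : uMat X = blk 1 X 0 1 := by
  ext i j
  fin_cases i <;> fin_cases j <;> simp [blk, uMat]

theorem embedT_eq (g : Matrix (Fin 2) (Fin 2) ℝ) :
    embedT g = blk g 0 0 (g.det • (g⁻¹)ᵀ) := by
  ext i j
  fin_cases i <;> fin_cases j <;> simp [blk, embedT]

theorem midRep_eq (t : Matrix (Fin 2) (Fin 2) ℝ) (lam z : ℝ) :
    midRep t lam z = blk (lam • (t * !![z, 0; 0, z⁻¹])) 0 0 ((t⁻¹)ᵀ * !![z⁻¹, 0; 0, z]) := by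
  ext i j
  fin_cases i <;> fin_cases j <;> simp [blk, midRep]

theorem blk_inj {A B C D A' B' C' D' : Matrix (Fin 2) (Fin 2) ℝ}
    (h : blk A B C D = blk A' B' C' D') : A = A' ∧ B = B' ∧ C = C' ∧ D = D' := by
  have e : ∀ i j, blk A B C D i j = blk A' B' C' D' i j := fun i j => by rw [h]
  refine ⟨?_, ?_, ?_, ?_⟩ <;> ext i j <;> fin_cases i <;> fin_cases j
  · simpa [blk] using e 0 0
  · simpa [blk] using e 0 1
  · simpa [blk] using e 1 0
  · simpa [blk] using e 1 1
  · simpa [blk] using e 0 2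
  · simpa [blk] using e 0 3
  · simpa [blk] using e 1 2
  · simpa [blk] using e 1 3
  · simpa [blk] using e 2 0
  · simpa [blk] using e 2 1
  · simpa [blk] using e 3 0
  · simpa [blk] using e 3 1
  · simpa [blk] using e 2 2
  · simpa [blk] using e 2 3
  · simpa [blk] using e 3 2
  · simpa [blk] using e 3 3

theorem exists_blk (h : Matrix (Fin 4) (Fin 4) ℝ) : ∃ A B C D, h = blk A B C D := by
  refine ⟨!![h 0 0, h 0 1; h 1 0, h 1 1], !![h 0 2, h 0 3; h 1 2, h 1 3],
    !![h 2 0, h 2 1; h 3 0, h 3 1], !![h 2 2, h 2 3; h 3 2, h 3 3], ?_⟩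
  ext i j
  fin_cases i <;> fin_cases j <;> simp [blk]

/-- Conformal 2×2 matrices. -/
def cf (p q : ℝ) : Matrix (Fin 2) (Fin 2) ℝ := !![p, q; -q, p]

theorem cf_det (p q : ℝ) : (cf p q).det = p ^ 2 + q ^ 2 := by
  simp [cf, Matrix.det_fin_two]; ring

theorem cf_mul_tr (p q : ℝ) : cf p q * (cf p q)ᵀ = (p ^ 2 + q ^ 2) • 1 := by
  ext i j
  fin_cases i <;> fin_cases j <;> simp [cf, Matrix.mul_apply, Fin.sum_univ_two] <;> ring

theorem cf_tr_mul (p q : ℝ) : (cf p q)ᵀ * cf p q = (p ^ 2 + q ^ 2) • 1 := by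
  ext i j
  fin_cases i <;> fin_cases j <;> simp [cf, Matrix.mul_apply, Fin.sum_univ_two] <;> ring

/-- The hypothesis on `t₀` forces `ᵗt₀ S t₀` to be a positive scalar. -/
theorem conformal_of_hyp (S : Matrix (Fin 2) (Fin 2) ℝ) (hS : S.PosDef)
    (t t1 : Matrix (Fin 2) (Fin 2) ℝ) (h10 : t1 * t = 1)
    (hinv : t⁻¹ = t1)
    (hT1 : ∀ g : Matrix (Fin 2) (Fin 2) ℝ,
      (gᵀ * S * g = S ∧ g.det = 1) ↔ ∃ θ : ℝ, g = t * rot θ * t⁻¹) :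
    ∃ s : ℝ, 0 < s ∧ tᵀ * S * t = s • 1 := by
  obtain ⟨h1, -⟩ := (hT1 (t * rot (π / 2) * t⁻¹)).2 ⟨_, rfl⟩
  rw [hinv] at h1
  set ρ := rot (π / 2) with hρ
  have hρ' : ρ = !![0, 1; -1, 0] := by rw [hρ]; simp [rot]
  have hN : ρᵀ * (tᵀ * S * t) * ρ = tᵀ * S * t := by
    have h2 : tᵀ * ((t * ρ * t1)ᵀ * S * (t * ρ * t1)) * t = tᵀ * S * t := by rw [h1]
    refine Eq.trans ?_ h2
    have h3 : tᵀ * t1ᵀ = 1 := by rw [← Matrix.transpose_mul, h10]; simp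
    simp only [Matrix.transpose_mul, Matrix.mul_assoc, h10, Matrix.mul_one]
    simp only [← Matrix.mul_assoc, h3, Matrix.one_mul]
  have hsym : (tᵀ * S * t)ᵀ = tᵀ * S * t := by
    have : Sᵀ = S := by
      have := hS.isHermitian
      rw [Matrix.IsHermitian, Matrix.conjTranspose_eq_transpose_of_trivial] at this
      exact this
    simp [Matrix.transpose_mul, this, Matrix.mul_assoc]
  have hpos : (tᵀ * S * t).PosDef := by
    have := hS.conjTranspose_mul_mul_same (B := t) (by
      apply Function.LeftInverse.injective (g := fun v => t1 *ᵥ v)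
      intro v
      show t1 *ᵥ (t *ᵥ v) = v
      rw [Matrix.mulVec_mulVec, h10, Matrix.one_mulVec])
    rwa [Matrix.conjTranspose_eq_transpose_of_trivial] at this
  generalize tᵀ * S * t = N at *
  refine ⟨N 0 0, hpos.diag_pos, ?_⟩
  rw [hρ'] at hN
  have e := fun i j => congrFun (congrFun hN i) j
  have e00 := e 0 0
  have e01 := e 0 1
  have s01 := congrFun (congrFun hsym 0) 1
  simp [Matrix.mul_apply, Fin.sum_univ_two] at e00 e01 s01
  ext i j
  fin_cases i <;> fin_cases j <;> simp <;> linarith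

theorem T_char {S t t1 : Matrix (Fin 2) (Fin 2) ℝ} {s : ℝ} (hs : 0 < s)
    (h10 : t1 * t = 1) (h01 : t * t1 = 1) (hN : tᵀ * S * t = s • 1)
    (g : Matrix (Fin 2) (Fin 2) ℝ) (hg : gᵀ * S * g = g.det • S) :
    ∃ p q : ℝ, g.det = p ^ 2 + q ^ 2 ∧ g = t * cf p q * t1 := by
  obtain ⟨g', hg'⟩ : ∃ g', g' = t1 * g * t := ⟨_, rfl⟩
  have hgg : g = t * g' * t1 := by
    rw [hg']
    simp only [Matrix.mul_assoc, h01, Matrix.mul_one]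
    simp only [← Matrix.mul_assoc, h01, Matrix.one_mul]
  have hd : g.det = g'.det := by
    have : t.det * t1.det = 1 := by rw [← Matrix.det_mul, h01, Matrix.det_one]
    rw [hgg, Matrix.det_mul, Matrix.det_mul]
    linear_combination g'.det * this
  have h3 : s • (g'ᵀ * g') = (g.det * s) • (1 : Matrix (Fin 2) (Fin 2) ℝ) := by
    have : s • (g'ᵀ * g') = g'ᵀ * (tᵀ * S * t) * g' := by
      rw [hN]; simp
    rw [this]
    have h4 : t * g' = g * t := by
      rw [hgg]; simp only [Matrix.mul_assoc, h10, Matrix.mul_one]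
    have : g'ᵀ * (tᵀ * S * t) * g' = (t * g')ᵀ * S * (t * g') := by
      simp only [Matrix.transpose_mul, Matrix.mul_assoc]
    rw [this, h4]
    have : (g * t)ᵀ * S * (g * t) = tᵀ * (gᵀ * S * g) * t := by
      simp only [Matrix.transpose_mul, Matrix.mul_assoc]
    rw [this, hg, Matrix.mul_smul, Matrix.smul_mul, hN, smul_smul]
  have e := fun i j => congrFun (congrFun h3 i) j
  have e00 := e 0 0
  have e01 := e 0 1
  have e11 := e 1 1
  simp [Matrix.mul_apply, Fin.sum_univ_two] at e00 e01 e11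
  have f00 : g' 0 0 * g' 0 0 + g' 1 0 * g' 1 0 = g.det := by
    apply mul_left_cancel₀ hs.ne'; linarith
  have f11 : g' 0 1 * g' 0 1 + g' 1 1 * g' 1 1 = g.det := by
    apply mul_left_cancel₀ hs.ne'; linarith
  have fd : g.det = g' 0 0 * g' 1 1 - g' 0 1 * g' 1 0 := by
    rw [hd, Matrix.det_fin_two]
  have hsum : (g' 0 0 - g' 1 1) ^ 2 + (g' 0 1 + g' 1 0) ^ 2 = 0 := by nlinarith
  have z1 : g' 0 0 - g' 1 1 = 0 := by
    apply pow_eq_zero_iff (two_ne_zero) |>.1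
    nlinarith [sq_nonneg (g' 0 0 - g' 1 1), sq_nonneg (g' 0 1 + g' 1 0)]
  have z2 : g' 0 1 + g' 1 0 = 0 := by
    apply pow_eq_zero_iff (two_ne_zero) |>.1
    nlinarith [sq_nonneg (g' 0 0 - g' 1 1), sq_nonneg (g' 0 1 + g' 1 0)]
  have hcf : g' = cf (g' 0 0) (g' 0 1) := by
    ext i j
    fin_cases i <;> fin_cases j <;> simp [cf] <;> linarith
  refine ⟨g' 0 0, g' 0 1, ?_, ?_⟩
  · rw [hd]; conv_lhs => rw [hcf]
    exact cf_det _ _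
  · rw [← hcf]; exact hgg

/-- `det(g) ᵗg⁻¹` for `g = t ρ t⁻¹`. -/
theorem dual_T {t t1 : Matrix (Fin 2) (Fin 2) ℝ}
    (h10 : t1 * t = 1) (h01 : t * t1 = 1) (p q : ℝ) (hpq : p ^ 2 + q ^ 2 ≠ 0) :
    (t * cf p q * t1).det = p ^ 2 + q ^ 2 ∧
    (t * cf p q * t1).det • ((t * cf p q * t1)⁻¹)ᵀ = t1ᵀ * cf p q * tᵀ := by
  have hd : (t * cf p q * t1).det = p ^ 2 + q ^ 2 := by
    have : t.det * t1.det = 1 := by rw [← Matrix.det_mul, h01, Matrix.det_one]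
    rw [Matrix.det_mul, Matrix.det_mul, cf_det]
    linear_combination (p ^ 2 + q ^ 2) * this
  refine ⟨hd, ?_⟩
  have hi : (t * cf p q * t1)⁻¹ = (p ^ 2 + q ^ 2)⁻¹ • (t * (cf p q)ᵀ * t1) := by
    apply Matrix.inv_eq_right_inv
    rw [Matrix.mul_smul]
    have : t * cf p q * t1 * (t * (cf p q)ᵀ * t1) = t * (cf p q * ((t1 * t) * (cf p q)ᵀ)) * t1 := by
      simp only [Matrix.mul_assoc]
    rw [this, h10, Matrix.one_mul, cf_mul_tr, Matrix.mul_smul, Matrix.smul_mul, Matrix.mul_one,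
      h01, smul_smul, inv_mul_cancel₀ hpq, one_smul]
  rw [hd, hi, Matrix.transpose_smul, smul_smul, mul_inv_cancel₀ hpq, one_smul]
  simp [Matrix.transpose_mul, Matrix.mul_assoc]

/-- Spectral decomposition of a positive definite 2×2 matrix. -/
theorem spectral2 (x y z : ℝ) (hx : 0 < x + z) (hd : 0 < x * z - y ^ 2) :
    ∃ c ζ p q : ℝ, 0 < c ∧ 1 ≤ ζ ∧ p ^ 2 + q ^ 2 = 1 ∧
      !![x, y; y, z] =
        cf (c * p) (c * q) * (!![ζ⁻¹, 0; 0, ζ] * !![ζ⁻¹, 0; 0, ζ]) * (cf (c * p) (c * q))ᵀ := by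
  obtain ⟨w, hw⟩ : ∃ w : ℂ, w = ⟨(z - x) / 2, y⟩ := ⟨_, rfl⟩
  have hre : ‖w‖ * Real.cos w.arg = (z - x) / 2 := by
    rw [Complex.norm_mul_cos_arg, hw]
  have him : ‖w‖ * Real.sin w.arg = y := by
    rw [Complex.norm_mul_sin_arg, hw]
  have hφ : w.arg = 2 * (w.arg / 2) := by ring
  have h0 : 0 ≤ ‖w‖ := norm_nonneg w
  rw [hφ, Real.cos_two_mul] at hre
  rw [hφ, Real.sin_two_mul] at him
  have hcs := Real.sin_sq_add_cos_sq (w.arg / 2)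
  generalize Real.cos (w.arg / 2) = p at *
  generalize Real.sin (w.arg / 2) = q at *
  generalize ‖w‖ = δ at *
  have hδ : δ ^ 2 = ((z - x) / 2) ^ 2 + y ^ 2 := by
    rw [← hre, ← him]
    have : q ^ 2 = 1 - p ^ 2 := by linarith
    linear_combination (-4 * δ ^ 2 * p ^ 2) * this
  have ha : 0 < (x + z) / 2 - δ := by
    have : δ ^ 2 < ((x + z) / 2) ^ 2 := by nlinarith
    have := lt_of_pow_lt_pow_left₀ 2 (by linarith) this
    linarith
  have hb : 0 < (x + z) / 2 + δ := by linarith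
  obtain ⟨α, hα, hα4⟩ : ∃ α : ℝ, 0 < α ∧ α ^ 4 = (x + z) / 2 - δ := by
    refine ⟨√(√((x + z) / 2 - δ)), by positivity, ?_⟩
    rw [show 4 = 2 * 2 from rfl, pow_mul, Real.sq_sqrt (by positivity), Real.sq_sqrt ha.le]
  obtain ⟨β, hβ, hβ4⟩ : ∃ β : ℝ, 0 < β ∧ β ^ 4 = (x + z) / 2 + δ := by
    refine ⟨√(√((x + z) / 2 + δ)), by positivity, ?_⟩
    rw [show 4 = 2 * 2 from rfl, pow_mul, Real.sq_sqrt (by positivity), Real.sq_sqrt hb.le]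
  have hαβ : α ≤ β := by
    apply le_of_pow_le_pow_left₀ (n := 4) (by norm_num) hβ.le
    linarith
  have k1 : α * β * (β / α)⁻¹ = α ^ 2 := by field_simp
  have k2 : α * β * (β / α) = β ^ 2 := by field_simp
  refine ⟨α * β, β / α, p, q, by positivity, by rwa [one_le_div hα], by linarith, ?_⟩
  generalize β / α = ζ at *
  generalize α * β = c at *
  have k3 : (c * ζ⁻¹) ^ 2 = (x + z) / 2 - δ := by rw [k1]; linarith
  have k4 : (c * ζ) ^ 2 = (x + z) / 2 + δ := by rw [k2]; linarith
  generalize ζ⁻¹ = ξ at *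
  have hq : q ^ 2 = 1 - p ^ 2 := by linarith
  ext i j
  fin_cases i <;> fin_cases j <;> simp [cf, Matrix.mul_apply, Fin.sum_univ_two]
  · linear_combination (-p ^ 2) * k3 - q ^ 2 * k4 - ((x+z)/2 + δ) * hq + hre
  · linear_combination (p * q) * k3 - p * q * k4 - him
  · linear_combination (p * q) * k3 - p * q * k4 - him
  · linear_combination (-q ^ 2) * k3 - p ^ 2 * k4 - ((x+z)/2 - δ) * hq - hre

/-- `h` is a similitude with multiplier `m`. -/
def sim (m : ℝ) (h : Matrix (Fin 4) (Fin 4) ℝ) : Prop := hᵀ * Jsp * h = m • Jsp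

theorem sim_mul {m n : ℝ} {h k : Matrix (Fin 4) (Fin 4) ℝ} (hh : sim m h) (hk : sim n k) :
    sim (m * n) (h * k) := by
  unfold sim at *
  have : (h * k)ᵀ * Jsp * (h * k) = kᵀ * (hᵀ * Jsp * h) * k := by
    simp only [Matrix.transpose_mul, Matrix.mul_assoc]
  rw [this, hh, Matrix.mul_smul, Matrix.smul_mul, hk, smul_smul]

theorem sim_blk_iff (m : ℝ) (A B C D : Matrix (Fin 2) (Fin 2) ℝ) :
    sim m (blk A B C D) ↔ blk (Aᵀ * C - Cᵀ * A) (Aᵀ * D - Cᵀ * B) (Bᵀ * C - Dᵀ * A)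
      (Bᵀ * D - Dᵀ * B) = blk 0 (m • 1) (-(m • 1)) 0 := by
  unfold sim
  rw [Jsp_eq, blk_transpose, blk_mul, blk_mul, blk_smul]
  have e : ∀ X Y Z W : Matrix (Fin 2) (Fin 2) ℝ,
      (X * 0 + Y * -1) * Z + (X * 1 + Y * 0) * W = X * W - Y * Z := by
    intro X Y Z W
    simp [sub_eq_add_neg, add_comm]
  simp only [e, smul_zero, smul_neg]

theorem sim_diag {m : ℝ} {A D : Matrix (Fin 2) (Fin 2) ℝ} (h : Aᵀ * D = m • 1) :
    sim m (blk A 0 0 D) := by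
  rw [sim_blk_iff]
  have : Dᵀ * A = m • 1 := by
    have := congrArg Matrix.transpose h
    simpa [Matrix.transpose_mul] using this
  simp [h, this]

theorem sim_uMat {X : Matrix (Fin 2) (Fin 2) ℝ} (h : Xᵀ = X) : sim 1 (uMat X) := by
  rw [uMat_eq, sim_blk_iff]
  simp [h]

theorem Jsp_sq : Jsp * Jsp = -1 := by
  rw [Jsp_eq, blk_mul]
  rw [← blk_one]
  ext i j
  fin_cases i <;> fin_cases j <;> simp [blk]

theorem sim_transpose {m : ℝ} (hm : m ≠ 0) {h : Matrix (Fin 4) (Fin 4) ℝ} (hh : sim m h) :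
    sim m hᵀ := by
  unfold sim at *
  rw [Matrix.transpose_transpose]
  have h1 : (-m⁻¹ • (Jsp * hᵀ * Jsp)) * h = 1 := by
    have : Jsp * hᵀ * Jsp * h = Jsp * (hᵀ * Jsp * h) := by simp only [Matrix.mul_assoc]
    rw [Matrix.smul_mul, this, hh, Matrix.mul_smul, Jsp_sq, smul_smul]
    rw [neg_mul, inv_mul_cancel₀ hm]; simp
  have h2 := mul_eq_one_comm.1 h1
  have h3 : h * Jsp * hᵀ * Jsp = (-m) • 1 := by
    rw [← h2, Matrix.mul_smul, smul_smul]
    have : -m * -m⁻¹ = 1 := by field_simp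
    rw [this, one_smul]
    simp only [Matrix.mul_assoc]
  have h4 := congrArg (· * Jsp) h3
  simp only [Matrix.mul_assoc, Jsp_sq] at h4
  simp only [Matrix.mul_assoc]
  simpa using h4

theorem KH_facts {k : Matrix (Fin 4) (Fin 4) ℝ} (hk : k ∈ KHset) :
    sim 1 k ∧ ∃ A B, k = blk A B (-B) A ∧ B * Bᵀ + A * Aᵀ = 1 := by
  obtain ⟨A, B, h1, h2, h3⟩ := hk
  have hk : k = blk A B (-B) A := by
    rw [h3]; ext i j; fin_cases i <;> fin_cases j <;> simp [blk]
  have h4 : kᵀ * k = 1 := by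
    rw [hk, blk_transpose, blk_mul, ← blk_one]
    have e1 : Bᵀ * B + Aᵀ * A = 1 := by rw [add_comm, h2]
    simp [h1, h2, e1]
  have h5 := mul_eq_one_comm.1 h4
  constructor
  · rw [hk, sim_blk_iff]
    have e1 : Bᵀ * B + Aᵀ * A = 1 := by rw [add_comm, h2]
    have e2 : -(Bᵀ * B) - Aᵀ * A = -1 := by rw [← e1]; abel
    simp [h1, h2, e2]
  · refine ⟨A, B, hk, ?_⟩
    rw [hk, blk_transpose, blk_mul, ← blk_one] at h5
    obtain ⟨-, -, -, h6⟩ := blk_inj h5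
    simpa using h6

theorem diag_mul_inv (z : ℝ) (hz : z ≠ 0) : !![z, 0; 0, z⁻¹] * !![z⁻¹, 0; 0, z] = 1 := by
  ext i j
  fin_cases i <;> fin_cases j <;> simp [Matrix.mul_apply, Fin.sum_univ_two, hz]

theorem diag_tr (z w : ℝ) : !![z, 0; 0, w]ᵀ = !![z, 0; 0, w] := by
  ext i j
  fin_cases i <;> fin_cases j <;> simp

theorem rm_form {t t1 : Matrix (Fin 2) (Fin 2) ℝ}
    (h10 : t1 * t = 1) (h01 : t * t1 = 1) (hinv : t⁻¹ = t1)
    (p q : ℝ) (hpq : p ^ 2 + q ^ 2 ≠ 0) (X : Matrix (Fin 2) (Fin 2) ℝ) (hX : Xᵀ = X)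
    (lam z : ℝ) (hz : z ≠ 0) :
    embedT (t * cf p q * t1) * uMat X * midRep t lam z =
      blk (lam • (t * cf p q * !![z, 0; 0, z⁻¹]))
        (t * cf p q * t1 * X * t1ᵀ * !![z⁻¹, 0; 0, z]) 0 (t1ᵀ * cf p q * !![z⁻¹, 0; 0, z]) ∧
    sim ((p ^ 2 + q ^ 2) * lam) (embedT (t * cf p q * t1) * uMat X * midRep t lam z) := by
  obtain ⟨-, hdual⟩ := dual_T h10 h01 p q hpq
  have c1 : ∀ Z : Matrix (Fin 2) (Fin 2) ℝ, t1 * (t * Z) = Z := fun Z => by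
    rw [← Matrix.mul_assoc, h10, Matrix.one_mul]
  have h3 : tᵀ * t1ᵀ = 1 := by rw [← Matrix.transpose_mul, h10]; simp
  have h4 : t1ᵀ * tᵀ = 1 := by rw [← Matrix.transpose_mul, h01]; simp
  have c3 : ∀ Z : Matrix (Fin 2) (Fin 2) ℝ, tᵀ * (t1ᵀ * Z) = Z := fun Z => by
    rw [← Matrix.mul_assoc, h3, Matrix.one_mul]
  have c5 : ∀ Z : Matrix (Fin 2) (Fin 2) ℝ, (cf p q)ᵀ * (cf p q * Z) = (p ^ 2 + q ^ 2) • Z :=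
    fun Z => by rw [← Matrix.mul_assoc, cf_tr_mul, Matrix.smul_mul, Matrix.one_mul]
  rw [embedT_eq, hdual, midRep_eq, hinv]
  constructor
  · rw [uMat_eq, blk_mul, blk_mul]
    congr 1 <;> simp [Matrix.mul_assoc, c1, c3]
  · have s1 : sim (p ^ 2 + q ^ 2) (blk (t * cf p q * t1) 0 0 (t1ᵀ * cf p q * tᵀ)) := by
      apply sim_diag
      simp only [Matrix.transpose_mul, Matrix.mul_assoc, c3, c5, Matrix.mul_smul, h4]
    have s3 : sim lam (blk (lam • (t * !![z, 0; 0, z⁻¹])) 0 0 (t1ᵀ * !![z⁻¹, 0; 0, z])) := by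
      apply sim_diag
      rw [Matrix.transpose_smul, Matrix.smul_mul, Matrix.transpose_mul, diag_tr, Matrix.mul_assoc,
        c3, diag_mul_inv z hz]
    have := sim_mul (sim_mul s1 (sim_uMat hX)) s3
    rwa [mul_one] at this

theorem bottom_posDef {A B C D : Matrix (Fin 2) (Fin 2) ℝ} {m : ℝ} (hm : m ≠ 0)
    (h : A * Dᵀ - B * Cᵀ = m • 1) : (C * Cᵀ + D * Dᵀ).PosDef := by
  have hsymm : (C * Cᵀ + D * Dᵀ).IsHermitian := by
    rw [Matrix.IsHermitian, Matrix.conjTranspose_eq_transpose_of_trivial]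
    simp [Matrix.transpose_mul]
  refine Matrix.PosDef.of_dotProduct_mulVec_pos hsymm ?_
  intro v hv
  have e : star v ⬝ᵥ (C * Cᵀ + D * Dᵀ) *ᵥ v
      = (Cᵀ *ᵥ v) ⬝ᵥ (Cᵀ *ᵥ v) + (Dᵀ *ᵥ v) ⬝ᵥ (Dᵀ *ᵥ v) := by
    rw [star_trivial, Matrix.add_mulVec, dotProduct_add, ← Matrix.mulVec_mulVec, ← Matrix.mulVec_mulVec,
      Matrix.dotProduct_mulVec v C, Matrix.dotProduct_mulVec v D,
      Matrix.mulVec_transpose, Matrix.mulVec_transpose]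
  have n1 : 0 ≤ (Cᵀ *ᵥ v) ⬝ᵥ (Cᵀ *ᵥ v) := Finset.sum_nonneg fun i _ => mul_self_nonneg _
  have n2 : 0 ≤ (Dᵀ *ᵥ v) ⬝ᵥ (Dᵀ *ᵥ v) := Finset.sum_nonneg fun i _ => mul_self_nonneg _
  rw [e]
  by_contra hcon
  have z1 : Cᵀ *ᵥ v = 0 := dotProduct_self_eq_zero.1 (by linarith)
  have z2 : Dᵀ *ᵥ v = 0 := dotProduct_self_eq_zero.1 (by linarith)
  apply hv
  have : (A * Dᵀ - B * Cᵀ) *ᵥ v = 0 := by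
    rw [Matrix.sub_mulVec, ← Matrix.mulVec_mulVec, ← Matrix.mulVec_mulVec, z1, z2]; simp
  rw [h, Matrix.smul_mulVec, Matrix.one_mulVec] at this
  exact (smul_eq_zero.1 this).resolve_left hm

/-- Iwasawa-type step with a prescribed factorisation `C ᵗC + D ᵗD = M ᵗM`. -/
theorem iwasawa {A B C D M M1 : Matrix (Fin 2) (Fin 2) ℝ} {m : ℝ} (hm : m ≠ 0)
    (hh : sim m (blk A B C D)) (hM : M * M1 = 1) (hP : C * Cᵀ + D * Dᵀ = M * Mᵀ) :
    ∃ k ∈ KHset, ∃ A1 B1, blk A B C D = blk A1 B1 0 M * k ∧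
      A1ᵀ * M = m • 1 ∧ B1ᵀ * M = Mᵀ * B1 := by
  have hM' : M1 * M = 1 := mul_eq_one_comm.1 hM
  have ht := sim_transpose hm hh
  rw [blk_transpose, sim_blk_iff] at ht
  simp only [Matrix.transpose_transpose] at ht
  obtain ⟨-, -, -, hCD⟩ := blk_inj ht
  have hCD : C * Dᵀ = D * Cᵀ := sub_eq_zero.1 hCD
  have hMt : Mᵀ * M1ᵀ = 1 := by rw [← Matrix.transpose_mul, hM', Matrix.transpose_one]
  obtain ⟨A', hA'⟩ : ∃ A', A' = M1 * D := ⟨_, rfl⟩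
  obtain ⟨B', hB'⟩ : ∃ B', B' = -(M1 * C) := ⟨_, rfl⟩
  have k1 : A' * A'ᵀ + B' * B'ᵀ = 1 := by
    have : A' * A'ᵀ + B' * B'ᵀ = M1 * (C * Cᵀ + D * Dᵀ) * M1ᵀ := by
      rw [hA', hB']
      simp only [Matrix.transpose_mul, Matrix.transpose_neg, Matrix.mul_assoc, Matrix.mul_add,
        Matrix.add_mul, neg_mul_neg]
      rw [add_comm]
    rw [this, hP, ← Matrix.mul_assoc, hM', Matrix.one_mul, hMt]
  have k2 : A' * B'ᵀ = B' * A'ᵀ := by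
    rw [hA', hB']
    simp only [Matrix.transpose_mul, Matrix.transpose_neg, Matrix.mul_neg, Matrix.neg_mul]
    congr 1
    have : M1 * D * (Cᵀ * M1ᵀ) = M1 * (D * Cᵀ) * M1ᵀ := by simp only [Matrix.mul_assoc]
    rw [this, ← hCD]
    simp only [Matrix.mul_assoc]
  obtain ⟨k, hk⟩ : ∃ k, k = blk A' B' (-B') A' := ⟨_, rfl⟩
  have hkk : k * kᵀ = 1 := by
    rw [hk, blk_transpose, blk_mul, ← blk_one]
    have : B' * B'ᵀ + A' * A'ᵀ = 1 := by rw [add_comm, k1]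
    simp [k1, k2, this]
  have hkk' := mul_eq_one_comm.1 hkk
  have hkK : k ∈ KHset := by
    have h7 := hkk'
    rw [hk, blk_transpose, blk_mul, ← blk_one] at h7
    obtain ⟨h8, h9, -, -⟩ := blk_inj h7
    refine ⟨A', B', ?_, ?_, ?_⟩
    · have h9' : A'ᵀ * B' - B'ᵀ * A' = 0 := by
        rw [← h9]; simp [sub_eq_add_neg]
      exact sub_eq_zero.1 h9'
    · simpa using h8
    · rw [hk]; ext i j; fin_cases i <;> fin_cases j <;> simp [blk]
  have hks := sim_transpose one_ne_zero (KH_facts hkK).1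
  have hprod := sim_mul hh hks
  rw [mul_one] at hprod
  have hform : blk A B C D * kᵀ = blk (A * A'ᵀ + B * B'ᵀ) (-(A * B'ᵀ) + B * A'ᵀ) 0 M := by
    rw [hk, blk_transpose, blk_mul]
    congr 1
    · simp
    · rw [hA', hB']
      simp only [Matrix.transpose_mul, Matrix.transpose_neg, Matrix.mul_neg]
      rw [← Matrix.mul_assoc, ← Matrix.mul_assoc, hCD]; simp
    · rw [hA', hB']
      simp only [Matrix.transpose_mul, Matrix.transpose_neg, Matrix.mul_neg, neg_neg]
      rw [← Matrix.mul_assoc, ← Matrix.mul_assoc, ← Matrix.add_mul, hP, Matrix.mul_assoc, hMt,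
        Matrix.mul_one]
  rw [hform, sim_blk_iff] at hprod
  obtain ⟨-, q2, -, q4⟩ := blk_inj hprod
  refine ⟨k, hkK, A * A'ᵀ + B * B'ᵀ, -(A * B'ᵀ) + B * A'ᵀ, ?_, ?_, ?_⟩
  · rw [← hform, Matrix.mul_assoc, hkk', Matrix.mul_one]
  · simpa using q2
  · exact sub_eq_zero.1 q4

theorem existence_part {S t t1 : Matrix (Fin 2) (Fin 2) ℝ} {s : ℝ}
    (h10 : t1 * t = 1) (h01 : t * t1 = 1) (hinv : t⁻¹ = t1) (hs : 0 < s)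
    (hN : tᵀ * S * t = s • 1)
    (h : Matrix (Fin 4) (Fin 4) ℝ) (hh : memH h) :
    ∃ r ∈ Rset S, ∃ lam : ℝ, lam ≠ 0 ∧ ∃ ζ : ℝ, 1 ≤ ζ ∧ ∃ k ∈ KHset,
        h = r * midRep t lam ζ * k := by
  obtain ⟨m, hm, hh⟩ := hh
  change sim m h at hh
  obtain ⟨A, B, C, D, rfl⟩ := exists_blk h
  have h3 : tᵀ * t1ᵀ = 1 := by rw [← Matrix.transpose_mul, h10]; simp
  have h4 : t1ᵀ * tᵀ = 1 := by rw [← Matrix.transpose_mul, h01]; simp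
  have c1 : ∀ Z : Matrix (Fin 2) (Fin 2) ℝ, t1 * (t * Z) = Z := fun Z => by
    rw [← Matrix.mul_assoc, h10, Matrix.one_mul]
  have c2 : ∀ Z : Matrix (Fin 2) (Fin 2) ℝ, t * (t1 * Z) = Z := fun Z => by
    rw [← Matrix.mul_assoc, h01, Matrix.one_mul]
  have c3 : ∀ Z : Matrix (Fin 2) (Fin 2) ℝ, tᵀ * (t1ᵀ * Z) = Z := fun Z => by
    rw [← Matrix.mul_assoc, h3, Matrix.one_mul]
  have c4 : ∀ Z : Matrix (Fin 2) (Fin 2) ℝ, t1ᵀ * (tᵀ * Z) = Z := fun Z => by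
    rw [← Matrix.mul_assoc, h4, Matrix.one_mul]
  have ht := sim_transpose hm hh
  rw [blk_transpose, sim_blk_iff] at ht
  simp only [Matrix.transpose_transpose] at ht
  obtain ⟨-, hAD, -, -⟩ := blk_inj ht
  have hP := bottom_posDef hm hAD
  have hQ : (tᵀ * (C * Cᵀ + D * Dᵀ) * t).PosDef := by
    have := hP.conjTranspose_mul_mul_same (B := t) (by
      apply Function.LeftInverse.injective (g := fun v => t1 *ᵥ v)
      intro v
      show t1 *ᵥ (t *ᵥ v) = v
      rw [Matrix.mulVec_mulVec, h10, Matrix.one_mulVec])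
    rwa [Matrix.conjTranspose_eq_transpose_of_trivial] at this
  obtain ⟨P, hPe⟩ : ∃ P, P = C * Cᵀ + D * Dᵀ := ⟨_, rfl⟩
  rw [← hPe] at hQ
  obtain ⟨Q, hQe⟩ : ∃ Q, Q = tᵀ * P * t := ⟨_, rfl⟩
  rw [← hQe] at hQ
  have hsymQ : Q 1 0 = Q 0 1 := by
    have := hQ.isHermitian.apply 0 1
    simpa using this
  have hdetQ := hQ.det_pos
  rw [Matrix.det_fin_two, hsymQ] at hdetQ
  have d0 : 0 < Q 0 0 := hQ.diag_pos
  have d1 : 0 < Q 1 1 := hQ.diag_pos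
  obtain ⟨c, ζ, p, q, hc, hζ, hpq, hspec⟩ :=
    spectral2 (Q 0 0) (Q 0 1) (Q 1 1) (by linarith) (by nlinarith)
  have hQ2 : !![Q 0 0, Q 0 1; Q 0 1, Q 1 1] = Q := by
    ext i j; fin_cases i <;> fin_cases j <;> simp [hsymQ]
  rw [hQ2] at hspec
  have hζ0 : ζ ≠ 0 := by linarith
  have hcpq : (c * p) ^ 2 + (c * q) ^ 2 = c ^ 2 := by
    linear_combination c ^ 2 * hpq
  have hc2 : c ^ 2 ≠ 0 := by positivity
  have hcpq0 : (c * p) ^ 2 + (c * q) ^ 2 ≠ 0 := by rw [hcpq]; exact hc2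
  have r1 := cf_mul_tr (c * p) (c * q)
  have r2 := cf_tr_mul (c * p) (c * q)
  obtain ⟨hgd, hgdual⟩ := dual_T h10 h01 (c * p) (c * q) hcpq0
  have hrm := fun X hX => (rm_form h10 h01 hinv (c * p) (c * q) hcpq0 X hX (m / c ^ 2) ζ hζ0).1
  rw [hcpq] at r1 r2 hgd
  obtain ⟨R, hR⟩ : ∃ R, R = cf (c * p) (c * q) := ⟨_, rfl⟩
  rw [← hR] at r1 r2 hgd hspec hrm
  have c5 : ∀ Z : Matrix (Fin 2) (Fin 2) ℝ, Rᵀ * (R * Z) = c ^ 2 • Z :=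
    fun Z => by rw [← Matrix.mul_assoc, r2, Matrix.smul_mul, Matrix.one_mul]
  have c6 : ∀ Z : Matrix (Fin 2) (Fin 2) ℝ, R * (Rᵀ * Z) = c ^ 2 • Z :=
    fun Z => by rw [← Matrix.mul_assoc, r1, Matrix.smul_mul, Matrix.one_mul]
  have hDD := diag_mul_inv ζ hζ0
  have tDp := diag_tr ζ ζ⁻¹
  have tDm := diag_tr ζ⁻¹ ζ
  generalize !![ζ, 0; 0, ζ⁻¹] = Dp at *
  generalize !![ζ⁻¹, 0; 0, ζ] = Dm at *
  have hDD' : Dm * Dp = 1 := mul_eq_one_comm.1 hDD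
  have c7 : ∀ Z : Matrix (Fin 2) (Fin 2) ℝ, Dm * (Dp * Z) = Z := fun Z => by
    rw [← Matrix.mul_assoc, hDD', Matrix.one_mul]
  obtain ⟨M, hMdef⟩ : ∃ M, M = t1ᵀ * R * Dm := ⟨_, rfl⟩
  obtain ⟨M1, hM1def⟩ : ∃ M1, M1 = (c ^ 2)⁻¹ • (Dp * Rᵀ * tᵀ) := ⟨_, rfl⟩
  have hMM : M * M1 = 1 := by
    rw [hMdef, hM1def, Matrix.mul_smul]
    simp only [Matrix.mul_assoc, c7, c6, Matrix.mul_smul, h4, smul_smul, inv_mul_cancel₀ hc2,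
      one_smul]
  have hPM : C * Cᵀ + D * Dᵀ = M * Mᵀ := by
    have : C * Cᵀ + D * Dᵀ = t1ᵀ * Q * t1 := by
      rw [← hPe, hQe]
      simp only [Matrix.mul_assoc, c4, h01, Matrix.mul_one]
    rw [this, hspec, hMdef]
    simp only [Matrix.transpose_mul, Matrix.transpose_transpose, tDm, Matrix.mul_assoc]
  obtain ⟨k, hkK, A1, B1, hfac, hA1, hB1⟩ := iwasawa hm hh hMM hPM
  have hMM' : M1 * M = 1 := mul_eq_one_comm.1 hMM
  have hMt : Mᵀ * M1ᵀ = 1 := by rw [← Matrix.transpose_mul, hMM', Matrix.transpose_one]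
  have hMt' : M1ᵀ * Mᵀ = 1 := mul_eq_one_comm.1 hMt
  obtain ⟨Z, hZ⟩ : ∃ Z, Z = B1 * M1 := ⟨_, rfl⟩
  have hZM : Z * M = B1 := by rw [hZ, Matrix.mul_assoc, hMM', Matrix.mul_one]
  have hZs : Zᵀ = Z := by
    have : Zᵀ = M1ᵀ * (B1ᵀ * M) * M1 := by
      rw [hZ, Matrix.transpose_mul]
      simp only [Matrix.mul_assoc, hMM, Matrix.mul_one]
    rw [this, hB1, ← Matrix.mul_assoc, hMt', Matrix.one_mul, hZ]
  obtain ⟨X, hX⟩ : ∃ X, X = (c ^ 2)⁻¹ • (t * Rᵀ * t1 * Z * t1ᵀ * R * tᵀ) := ⟨_, rfl⟩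
  have hXs : Xᵀ = X := by
    rw [hX]
    simp only [Matrix.transpose_smul, Matrix.transpose_mul, Matrix.transpose_transpose, hZs,
      Matrix.mul_assoc]
  refine ⟨embedT (t * R * t1) * uMat X, ⟨t * R * t1, X, ?_, ?_, hXs, rfl⟩, m / c ^ 2,
    div_ne_zero hm hc2, ζ, hζ, k, hkK, ?_⟩
  · rw [hgd]
    have hSe : S = s • (t1ᵀ * t1) := by
      have : S = t1ᵀ * (tᵀ * S * t) * t1 := by
        simp only [Matrix.mul_assoc, c4, h01, Matrix.mul_one]
      rw [this, hN, Matrix.mul_smul, Matrix.smul_mul, Matrix.mul_one]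
    rw [hSe]
    simp only [Matrix.transpose_mul, Matrix.mul_assoc, Matrix.mul_smul, Matrix.smul_mul, c1, c3, c5]
    rw [smul_comm]
  · rw [hgd]; exact hc2
  · rw [hrm X hXs, hfac]
    congr 1
    rw [← hMdef]
    have eA : A1 = (m / c ^ 2) • (t * R * Dp) := by
      have e1 : ((m / c ^ 2) • (t * R * Dp))ᵀ * M = m • 1 := by
        rw [hMdef, Matrix.transpose_smul, Matrix.smul_mul]
        simp only [Matrix.transpose_mul, tDp, Matrix.mul_assoc, c3, c5, Matrix.mul_smul, hDD,
          smul_smul]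
        rw [div_mul_cancel₀ _ hc2]
      have e2 : A1ᵀ = ((m / c ^ 2) • (t * R * Dp))ᵀ := by
        have := congrArg (· * M1) (hA1.trans e1.symm)
        simpa only [Matrix.mul_assoc, hMM, Matrix.mul_one] using this
      exact Matrix.transpose_injective e2
    have eB : B1 = t * R * t1 * X * t1ᵀ * Dm := by
      rw [← hZM, hX, hMdef]
      simp only [Matrix.mul_assoc, Matrix.mul_smul, Matrix.smul_mul, c1, c3, c6, c2, smul_smul,
        inv_mul_cancel₀ hc2, one_smul]
    rw [← eA, ← eB]

theorem trace_conf (p q z : ℝ) :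
    (cf p q * (!![z⁻¹, 0; 0, z] * !![z⁻¹, 0; 0, z]) * (cf p q)ᵀ).trace
      = (p ^ 2 + q ^ 2) * (z⁻¹ ^ 2 + z ^ 2) := by
  rw [Matrix.trace_fin_two]
  simp only [cf, Matrix.mul_apply, Fin.sum_univ_two, Matrix.transpose_apply]
  simp
  ring

theorem det_conf (p q z : ℝ) (hz : z ≠ 0) :
    (cf p q * (!![z⁻¹, 0; 0, z] * !![z⁻¹, 0; 0, z]) * (cf p q)ᵀ).det
      = (p ^ 2 + q ^ 2) ^ 2 := by
  rw [Matrix.det_mul, Matrix.det_mul, Matrix.det_mul, Matrix.det_transpose, cf_det,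
    Matrix.det_fin_two_of]
  simp [hz]; ring

theorem uniqueness_part {S t t1 : Matrix (Fin 2) (Fin 2) ℝ} {s : ℝ}
    (h10 : t1 * t = 1) (h01 : t * t1 = 1) (hinv : t⁻¹ = t1) (hs : 0 < s)
    (hN : tᵀ * S * t = s • 1)
    (r r' k k' : Matrix (Fin 4) (Fin 4) ℝ) (hr : r ∈ Rset S) (hr' : r' ∈ Rset S)
    (hk : k ∈ KHset) (hk' : k' ∈ KHset) (lam lam' ζ ζ' : ℝ)
    (hζ : 1 ≤ ζ) (hζ' : 1 ≤ ζ')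
    (heq : r * midRep t lam ζ * k = r' * midRep t lam' ζ' * k') :
    ζ = ζ' ∧ (0 < lam ↔ 0 < lam') := by
  obtain ⟨g, X, hg, hgd, hX, rfl⟩ := hr
  obtain ⟨g', X', hg', hgd', hX', rfl⟩ := hr'
  obtain ⟨p, q, hd, rfl⟩ := T_char hs h10 h01 hN g hg
  obtain ⟨p', q', hd', rfl⟩ := T_char hs h10 h01 hN g' hg'
  rw [hd] at hgd
  rw [hd'] at hgd'
  have hz0 : ζ ≠ 0 := by linarith
  have hz0' : ζ' ≠ 0 := by linarith
  obtain ⟨f1, s1⟩ := rm_form h10 h01 hinv p q hgd X hX lam ζ hz0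
  obtain ⟨f2, s2⟩ := rm_form h10 h01 hinv p' q' hgd' X' hX' lam' ζ' hz0'
  obtain ⟨ks, A, B, hkb, hkk⟩ := KH_facts hk
  obtain ⟨ks', A', B', hkb', hkk'⟩ := KH_facts hk'
  have pos : 0 < p ^ 2 + q ^ 2 := lt_of_le_of_ne (by positivity) hgd.symm
  have pos' : 0 < p' ^ 2 + q' ^ 2 := lt_of_le_of_ne (by positivity) hgd'.symm
  have hmult : (p ^ 2 + q ^ 2) * lam = (p' ^ 2 + q' ^ 2) * lam' := by
    have e1 := sim_mul s1 ks
    have e2 := sim_mul s2 ks'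
    rw [heq] at e1
    unfold sim at e1 e2
    have e3 := congrFun (congrFun (e1.symm.trans e2) 0) 2
    simpa [Jsp] using e3
  have hsign : 0 < lam ↔ 0 < lam' := by
    rw [← mul_pos_iff_of_pos_left pos, hmult, mul_pos_iff_of_pos_left pos']
  refine ⟨?_, hsign⟩
  rw [f1, f2, hkb, hkb', blk_mul, blk_mul] at heq
  obtain ⟨-, -, e3, e4⟩ := blk_inj heq
  simp only [Matrix.zero_mul, zero_add, Matrix.mul_neg, neg_inj] at e3 e4
  have key : ∀ M A B : Matrix (Fin 2) (Fin 2) ℝ, B * Bᵀ + A * Aᵀ = 1 →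
      (M * B) * (M * B)ᵀ + (M * A) * (M * A)ᵀ = M * Mᵀ := by
    intro M A B hAB
    have : (M * B) * (M * B)ᵀ + (M * A) * (M * A)ᵀ = M * (B * Bᵀ + A * Aᵀ) * Mᵀ := by
      simp only [Matrix.transpose_mul, Matrix.mul_assoc, Matrix.mul_add, Matrix.add_mul]
    rw [this, hAB, Matrix.mul_one]
  have hMM := key (t1ᵀ * cf p q * !![ζ⁻¹, 0; 0, ζ]) A B hkk
  rw [e3, e4, key _ A' B' hkk'] at hMM
  have h3 : tᵀ * t1ᵀ = 1 := by rw [← Matrix.transpose_mul, h10]; simp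
  have c3 : ∀ Z : Matrix (Fin 2) (Fin 2) ℝ, tᵀ * (t1ᵀ * Z) = Z := fun Z => by
    rw [← Matrix.mul_assoc, h3, Matrix.one_mul]
  have red : ∀ p q z : ℝ, tᵀ * ((t1ᵀ * cf p q * !![z⁻¹, 0; 0, z]) *
      (t1ᵀ * cf p q * !![z⁻¹, 0; 0, z])ᵀ) * t =
      cf p q * (!![z⁻¹, 0; 0, z] * !![z⁻¹, 0; 0, z]) * (cf p q)ᵀ := by
    intro p q z
    simp only [Matrix.transpose_mul, Matrix.transpose_transpose, diag_tr, Matrix.mul_assoc, c3,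
      h10, Matrix.mul_one]
  have hfin := (red p' q' ζ').symm.trans ((congrArg (fun N => tᵀ * N * t) hMM).trans (red p q ζ))
  have hdet := congrArg Matrix.det hfin
  have htr := congrArg Matrix.trace hfin
  rw [det_conf _ _ _ hz0, det_conf _ _ _ hz0'] at hdet
  rw [trace_conf, trace_conf] at htr
  have hdd : p' ^ 2 + q' ^ 2 = p ^ 2 + q ^ 2 :=
    (pow_left_inj₀ pos'.le pos.le two_ne_zero).1 hdet
  rw [hdd] at htr
  have hz := mul_left_cancel₀ hgd htr
  have hprod : (ζ' ^ 2 - ζ ^ 2) * (ζ' ^ 2 * ζ ^ 2 - 1) = 0 := by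
    field_simp at hz
    linear_combination hz
  have q1 : 1 ≤ ζ ^ 2 := by nlinarith
  have q2 : 1 ≤ ζ' ^ 2 := by nlinarith
  have hsq : ζ ^ 2 = ζ' ^ 2 := by
    rcases mul_eq_zero.1 hprod with h | h
    · linarith
    · nlinarith
  exact (pow_left_inj₀ (by linarith) (by linarith) two_ne_zero).1 hsq

/-- Decomposition `H(ℝ) = R(ℝ)·{diag-block(λt₀diag(ζ,ζ⁻¹), ᵀt₀⁻¹diag(ζ⁻¹,ζ))}·K^H_∞` with
`λ ∈ ℝ^×`, `ζ ≥ 1`, and disjointness of the double cosets for distinct parameters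
(`ζ`, and the sign of `λ`, which is all of `λ` that is well defined modulo the center). -/
theorem H_real_Bessel_double_coset_decomposition
    (S : Matrix (Fin 2) (Fin 2) ℝ) (hS : S.PosDef)
    (t₀ : Matrix (Fin 2) (Fin 2) ℝ) (ht₀ : 0 < t₀.det)
    (hT1 : ∀ g : Matrix (Fin 2) (Fin 2) ℝ,
      (gᵀ * S * g = S ∧ g.det = 1) ↔ ∃ θ : ℝ, g = t₀ * rot θ * t₀⁻¹) :
    (∀ h : Matrix (Fin 4) (Fin 4) ℝ, memH h →
      ∃ r ∈ Rset S, ∃ lam : ℝ, lam ≠ 0 ∧ ∃ ζ : ℝ, 1 ≤ ζ ∧ ∃ k ∈ KHset,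
        h = r * midRep t₀ lam ζ * k) ∧
    (∀ r ∈ Rset S, ∀ r' ∈ Rset S, ∀ k ∈ KHset, ∀ k' ∈ KHset,
      ∀ lam lam' ζ ζ' : ℝ, lam ≠ 0 → lam' ≠ 0 → 1 ≤ ζ → 1 ≤ ζ' →
        r * midRep t₀ lam ζ * k = r' * midRep t₀ lam' ζ' * k' →
          ζ = ζ' ∧ (0 < lam ↔ 0 < lam')) := by
  obtain ⟨t1, hinv⟩ : ∃ t1, t₀⁻¹ = t1 := ⟨_, rfl⟩
  have hu : IsUnit t₀.det := ht₀.ne'.isUnit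
  have h10 : t1 * t₀ = 1 := by rw [← hinv]; exact Matrix.nonsing_inv_mul _ hu
  have h01 : t₀ * t1 = 1 := by rw [← hinv]; exact Matrix.mul_nonsing_inv _ hu
  obtain ⟨s, hs, hN⟩ := conformal_of_hyp S hS t₀ t1 h10 hinv hT1
  refine ⟨fun h hh => existence_part h10 h01 hinv hs hN h hh, ?_⟩
  intro r hr r' hr' k hk k' hk' lam lam' ζ ζ' _ _ hζ hζ' heq
  exact uniqueness_part h10 h01 hinv hs hN r r' k k' hr hr' hk hk' lam lam' ζ ζ' hζ hζ' heq

end
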